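/- arXiv:1404.1112 — 8 statements merged into one kernel-verified Lean document; each statement's English description precedes it below -/
import Mathlib

section
/- A supply profile p ∈ ℕ^T is exactly adequate for a demand profile h = (h_1,…,h_N) with associated demand-duration vector d if and only if d ⪯ p, i.e., ∑_{s=t}^T d_s ≤ ∑_{s=t}^T p↓_s for every t = 1,…,T and ∑_{s=1}^T d_s = ∑_{s=1}^T p_s. -/
open Finset

/-- The nonincreasing rearrangement `a↓` of `a`. -/
def sortedDesc {T : ℕ} (a : Fin T → ℕ) : Fin T → ℕ := fun t => a (Tuple.sort a t.rev)

/-- The supply profile `p` is exactly adequate for the demand profile `h`. -/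
def IsExactlyAdequate {T N : ℕ} (p : Fin T → ℕ) (h : Fin N → ℕ) : Prop :=
  ∃ A : Fin N → Fin T → Bool,
    (∀ i, (∑ t, if A i t then 1 else 0) = h i) ∧
    (∀ t, (∑ i, if A i t then 1 else 0) = p t)

/-- The demand-duration vector of the demand profile `h`:
`d t` is the number of loads demanding at least `t+1` slots (`t` is 0-indexed). -/
def durations {T N : ℕ} (h : Fin N → ℕ) : Fin T → ℕ :=
  fun t => (univ.filter fun i => (t : ℕ) < h i).card

/-- The canonical allocation, serving each load in its first slots, is exactly supplied by the
demand-duration vector. -/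
theorem isExactlyAdequate_durations {T N : ℕ} (h : Fin N → ℕ) (hh : ∀ i, h i ≤ T) :
    IsExactlyAdequate (durations (T := T) h) h := by
  refine ⟨fun i t => decide ((t : ℕ) < h i), fun i => ?_, fun t => ?_⟩
  · simp [Fin.card_filter_val_lt, hh i]
  · simp [durations]

/-- Relabelling the slots preserves exact adequacy. -/
theorem IsExactlyAdequate.comp_equiv {T N : ℕ} {p : Fin T → ℕ} {h : Fin N → ℕ}
    (hp : IsExactlyAdequate p h) (e : Equiv.Perm (Fin T)) : IsExactlyAdequate (p ∘ e) h := by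
  obtain ⟨A, hrow, hcol⟩ := hp
  refine ⟨fun i t => A i (e t), fun i => ?_, fun t => hcol (e t)⟩
  rw [← hrow i]
  exact Equiv.sum_comp e fun t => if A i t = true then 1 else 0

theorem IsExactlyAdequate.sum_eq {T N : ℕ} {p : Fin T → ℕ} {h : Fin N → ℕ}
    (hp : IsExactlyAdequate p h) : ∑ t, p t = ∑ i, h i := by
  obtain ⟨A, hrow, hcol⟩ := hp
  simp only [← hrow, ← hcol]
  exact sum_comm

theorem IsExactlyAdequate.sum_Ici_durations_le {T N : ℕ} {p : Fin T → ℕ} {h : Fin N → ℕ}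
    (hp : IsExactlyAdequate p h) (hh : ∀ i, h i ≤ T) (t : Fin T) :
    ∑ s ∈ Ici t, durations (T := T) h s ≤ ∑ s ∈ Ici t, p s := by
  obtain ⟨A, hrow, hcol⟩ := hp
  simp only [← hcol, durations, card_filter]
  rw [sum_comm, sum_comm (s := Ici t)]
  refine sum_le_sum fun i _ => ?_
  by_cases hit : h i ≤ t
  · refine (sum_eq_zero fun s hs => if_neg ?_).trans_le (Nat.zero_le _)
    have : t ≤ s := mem_Ici.1 hs
    omega
  · have htotal : ∑ s : Fin T, (if (s : ℕ) < h i then 1 else 0) = h i := by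
      simp [Fin.card_filter_val_lt, hh i]
    have hsplit (f : Fin T → ℕ) : ∑ s, f s = ∑ s ∈ Ici t, f s + ∑ s ∈ Iio t, f s := by
      rw [← sum_add_sum_compl (Ici t) f]
      congr 2
      ext s
      simp
    have hle : ∑ s ∈ Iio t, (if A i s = true then 1 else 0) ≤
        ∑ s ∈ Iio t, (if (s : ℕ) < h i then 1 else 0) := by
      refine sum_le_sum fun s hs => ?_
      have : s < t := mem_Iio.1 hs
      rw [if_pos (show (s : ℕ) < h i by omega)]
      split_ifs <;> simp
    have hrow_i := hrow i
    rw [hsplit] at htotal hrow_i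
    omega

/-- Moving one unit of supply from a slot to a slot with less supply preserves exact adequacy. -/
theorem IsExactlyAdequate.transfer {T N : ℕ} {q q' : Fin T → ℕ} {h : Fin N → ℕ}
    (hq : IsExactlyAdequate q h) {a b : Fin T} (hab : q b < q a)
    (ha : q' a + 1 = q a) (hb : q' b = q b + 1) (hne : ∀ s, s ≠ a → s ≠ b → q' s = q s) :
    IsExactlyAdequate q' h := by
  obtain ⟨A, hrow, hcol⟩ := hq
  obtain ⟨j, -, hj⟩ : ∃ j ∈ univ, (if A j b = true then 1 else 0) < if A j a = true then 1 else 0 :=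
    exists_lt_of_sum_lt (by rwa [hcol, hcol])
  have hja : A j a = true := by
    by_contra hn
    simp [hn] at hj
  have hjb : A j b = false := by
    by_contra hn
    simp [hn, hja] at hj
  refine ⟨fun i s => if i = j then A i (Equiv.swap a b s) else A i s, fun i => ?_, fun s => ?_⟩
  · by_cases hij : i = j
    · simp only [hij, if_true]
      rw [← hrow j]
      exact Equiv.sum_comp (Equiv.swap a b) fun t => if A j t = true then 1 else 0
    · simpa only [hij, if_false] using hrow i
  · have hcol_s := hcol s
    rw [← add_sum_erase _ _ (mem_univ j)] at hcol_s ⊢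
    have hrest : ∑ i ∈ univ.erase j,
        (if (if i = j then A i (Equiv.swap a b s) else A i s) = true then 1 else 0) =
        ∑ i ∈ univ.erase j, if A i s = true then 1 else 0 :=
      sum_congr rfl fun i hi => by rw [if_neg (ne_of_mem_erase hi)]
    rw [hrest]
    simp only [if_true]
    by_cases hsa : s = a
    · subst hsa
      rw [if_pos hja] at hcol_s
      rw [Equiv.swap_apply_left, hjb, if_neg Bool.false_ne_true]
      omega
    · by_cases hsb : s = b
      · subst hsb
        rw [hjb, if_neg Bool.false_ne_true] at hcol_s
        rw [Equiv.swap_apply_right, if_pos hja]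
        omega
      · rw [Equiv.swap_apply_of_ne_of_ne hsa hsb, hcol_s, hne s hsa hsb]

/-- Exact adequacy passes from `q` to any nonincreasing `p` whose prefix sums are dominated by
those of `q`. -/
theorem IsExactlyAdequate.of_sum_Iic_le {T N : ℕ} {p q : Fin T → ℕ} {h : Fin N → ℕ}
    (hq : IsExactlyAdequate q h) (hp : Antitone p)
    (hle : ∀ t, ∑ s ∈ Iic t, p s ≤ ∑ s ∈ Iic t, q s) (hsum : ∑ s, q s = ∑ s, p s) :
    IsExactlyAdequate p h := by
  induction hn : ∑ s, (p s - q s) using Nat.strong_induction_on generalizing q with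
  | _ n ih =>
  by_cases hpq : ∀ s, p s ≤ q s
  · have : p = q := funext fun s =>
      (sum_eq_sum_iff_of_le fun s _ => hpq s).1 hsum.symm s (mem_univ s)
    rwa [this]
  push Not at hpq
  obtain ⟨b, hb, hmin⟩ := WellFounded.has_min (wellFounded_lt (α := Fin T)) {s | q s < p s} hpq
  have hbefore : ∀ s < b, p s ≤ q s := fun s hs => not_lt.1 fun hlt => hmin s hlt hs
  obtain ⟨a, hab, ha⟩ : ∃ a < b, p a < q a := by
    by_contra! hno
    refine (hle b).not_gt (sum_lt_sum (fun s hs => ?_) ⟨b, mem_Iic.2 le_rfl, hb⟩)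
    rcases (mem_Iic.1 hs).eq_or_lt with rfl | hs
    · exact hb.le
    · exact hno s hs
  have hb : q b < p b := hb
  have hpab := hp hab.le
  let q' : Fin T → ℕ := fun s => if s = a then q a - 1 else if s = b then q b + 1 else q s
  have hqa : q' a + 1 = q a := by simp only [q', if_true]; omega
  have hqb : q' b = q b + 1 := by simp [q', hab.ne']
  have hqs : ∀ s, s ≠ a → s ≠ b → q' s = q s := fun s h1 h2 => by simp [q', h1, h2]
  have hsum_eq (S : Finset (Fin T)) (haS : a ∈ S) (hbS : b ∈ S) :
      ∑ s ∈ S, q' s = ∑ s ∈ S, q s := by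
    have hbS' : b ∈ S.erase a := mem_erase.2 ⟨hab.ne', hbS⟩
    have hrest : ∑ s ∈ (S.erase a).erase b, q' s = ∑ s ∈ (S.erase a).erase b, q s :=
      sum_congr rfl fun s hs =>
        hqs s (ne_of_mem_erase (mem_of_mem_erase hs)) (ne_of_mem_erase hs)
    rw [← add_sum_erase _ _ haS, ← add_sum_erase _ _ hbS', ← add_sum_erase _ q haS,
      ← add_sum_erase _ q hbS', hrest]
    omega
  refine ih _ ?_ (hq.transfer (by omega) hqa hqb hqs) (fun t => ?_) ?_ rfl
  · rw [← hn]
    refine sum_lt_sum (fun s _ => ?_) ⟨b, mem_univ b, by omega⟩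
    by_cases hsa : s = a
    · subst hsa; omega
    · by_cases hsb : s = b
      · subst hsb; omega
      · rw [hqs s hsa hsb]
  · rcases lt_or_ge t b with htb | htb
    · refine sum_le_sum fun s hs => ?_
      have hsb : s < b := (mem_Iic.1 hs).trans_lt htb
      by_cases hsa : s = a
      · subst hsa; omega
      · rw [hqs s hsa hsb.ne]
        exact hbefore s hsb
    · rw [hsum_eq _ (mem_Iic.2 (hab.le.trans htb)) (mem_Iic.2 htb)]
      exact hle t
  · rw [hsum_eq _ (mem_univ a) (mem_univ b), hsum]

theorem antitone_sortedDesc {T : ℕ} (p : Fin T → ℕ) : Antitone (sortedDesc p) :=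
  fun _ _ hst => Tuple.monotone_sort p (Fin.rev_le_rev.2 hst)

theorem sortedDesc_eq_comp {T : ℕ} (p : Fin T → ℕ) :
    sortedDesc p = p ∘ (Fin.revPerm.trans (Tuple.sort p)) := rfl

theorem sum_sortedDesc {T : ℕ} (p : Fin T → ℕ) : ∑ t, sortedDesc p t = ∑ t, p t :=
  Equiv.sum_comp (Fin.revPerm.trans (Tuple.sort p)) p

theorem isExactlyAdequate_sortedDesc {T N : ℕ} {p : Fin T → ℕ} {h : Fin N → ℕ} :
    IsExactlyAdequate (sortedDesc p) h ↔ IsExactlyAdequate p h := by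
  rw [sortedDesc_eq_comp]
  refine ⟨fun hp => ?_, fun hp => hp.comp_equiv _⟩
  have := hp.comp_equiv (Fin.revPerm.trans (Tuple.sort p)).symm
  rwa [Function.comp_assoc, Equiv.self_comp_symm, Function.comp_id] at this

/-- Domination of tail sums with equal totals is domination of prefix sums in reverse. -/
theorem sum_Iic_le_of_sum_Ici_le {T : ℕ} {p q : Fin T → ℕ}
    (hle : ∀ t, ∑ s ∈ Ici t, q s ≤ ∑ s ∈ Ici t, p s) (hsum : ∑ s, q s = ∑ s, p s) (t : Fin T) :
    ∑ s ∈ Iic t, p s ≤ ∑ s ∈ Iic t, q s := by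
  have hsplit (f : Fin T → ℕ) : ∑ s, f s = ∑ s ∈ Iic t, f s + ∑ s ∈ Ioi t, f s := by
    rw [← sum_add_sum_compl (Iic t) f]
    congr 2
    ext s
    simp
  have htail : ∑ s ∈ Ioi t, q s ≤ ∑ s ∈ Ioi t, p s := by
    by_cases ht : (t : ℕ) + 1 < T
    · have : Ioi t = Ici (⟨t + 1, ht⟩ : Fin T) := by
        ext s
        simp only [mem_Ioi, mem_Ici, Fin.lt_def, Fin.le_def, Nat.succ_le_iff]
      rw [this]
      exact hle _
    · have : Ioi t = ∅ := by
        ext s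
        simp only [mem_Ioi, Fin.lt_def, notMem_empty, iff_false]
        omega
      simp [this]
  rw [hsplit q, hsplit p] at hsum
  omega

/-- `p` is exactly adequate for `h` iff the demand-duration vector `d` of `h`
is majorized by `p`: every tail sum of `d` is at most the corresponding tail sum
of the nonincreasing rearrangement `p↓`, and the totals agree. -/
theorem exactly_adequate_iff_majorized {T N : ℕ} (p : Fin T → ℕ) (h : Fin N → ℕ)
    (hh : ∀ i, h i ≤ T) :
    IsExactlyAdequate p h ↔
      ((∀ t : Fin T,
          ∑ s ∈ Ici t, durations (T := T) h s ≤ ∑ s ∈ Ici t, sortedDesc p s) ∧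
        ∑ s, durations (T := T) h s = ∑ s, p s) := by
  constructor
  · intro hp
    exact ⟨(isExactlyAdequate_sortedDesc.2 hp).sum_Ici_durations_le hh,
      (isExactlyAdequate_durations h hh).sum_eq.trans hp.sum_eq.symm⟩
  · rintro ⟨hle, hsum⟩
    rw [← sum_sortedDesc p] at hsum
    exact isExactlyAdequate_sortedDesc.1 <|
      (isExactlyAdequate_durations h hh).of_sum_Iic_le (antitone_sortedDesc p)
        (sum_Iic_le_of_sum_Ici_le hle hsum) hsum
end

section
/- A supply profile p ∈ ℕ^T is adequate for a demand profile h = (h_1,…,h_N) with associated demand-duration vector d if and only if d ⪯^w p, i.e., ∑_{s=t}^T d_s ≤ ∑_{s=t}^T p↓_s for every t = 1,…,T. -/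
open Finset

/-- The supply profile `p` is adequate for the demand profile `h`. -/
def IsAdequate {T N : ℕ} (p : Fin T → ℕ) (h : Fin N → ℕ) : Prop :=
  ∃ A : Fin N → Fin T → Bool,
    (∀ i, (∑ t, if A i t then 1 else 0) = h i) ∧
    (∀ t, (∑ i, if A i t then 1 else 0) ≤ p t)

/-- A set on which `f` is smallest has the least sum among all sets of its cardinality. -/
theorem sum_le_sum_of_card_eq {ι : Type*} [DecidableEq ι] {f : ι → ℕ} {A S : Finset ι}
    (hcard : A.card = S.card) (hf : ∀ a ∈ A, ∀ b ∉ A, f a ≤ f b) :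
    ∑ a ∈ A, f a ≤ ∑ b ∈ S, f b := by
  have hdiff : (A \ S).card = (S \ A).card := Finset.card_sdiff_comm hcard
  have hA : ∑ a ∈ A \ S, f a ≤ (A \ S).card • (A \ S).sup f :=
    sum_le_card_nsmul _ _ _ fun a ha => le_sup ha
  have hS : (S \ A).card • (A \ S).sup f ≤ ∑ b ∈ S \ A, f b :=
    card_nsmul_le_sum _ _ _ fun b hb => Finset.sup_le fun a ha =>
      hf a (mem_sdiff.1 ha).1 b (mem_sdiff.1 hb).2
  rw [hdiff] at hA
  rw [← sum_inter_add_sum_sdiff A S f, ← sum_inter_add_sum_sdiff S A f, inter_comm S A]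
  exact Nat.add_le_add_left (hA.trans hS) _

/-- A tail sum of the nonincreasing rearrangement is the least sum over sets of that size. -/
theorem exists_sum_Ici_sortedDesc_eq {T : ℕ} (p : Fin T → ℕ) (t : Fin T) :
    ∃ A : Finset (Fin T), A.card = T - t ∧ ∑ s ∈ Ici t, sortedDesc p s = ∑ a ∈ A, p a ∧
      ∀ S : Finset (Fin T), S.card = T - t → ∑ a ∈ A, p a ≤ ∑ b ∈ S, p b := by
  let e : Fin T ≃ Fin T := Fin.revPerm.trans (Tuple.sort p)
  have hcard : ((Ici t).map e.toEmbedding).card = T - t := by simp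
  refine ⟨(Ici t).map e.toEmbedding, hcard, ?_, fun S hS => ?_⟩
  · rw [sum_map]
    rfl
  · refine sum_le_sum_of_card_eq (hcard.trans hS.symm) fun a ha b hb => ?_
    obtain ⟨s, hs, rfl⟩ := mem_map.1 ha
    obtain ⟨r, rfl⟩ := e.surjective b
    have hr : r < t := by simpa using hb
    exact Tuple.monotone_sort p (Fin.rev_le_rev.2 (hr.le.trans (mem_Ici.1 hs)))

theorem sum_Ici_durations {T N : ℕ} (h : Fin N → ℕ) (hh : ∀ i, h i ≤ T) (t : Fin T) :
    ∑ s ∈ Ici t, durations (T := T) h s = ∑ i, (h i - t) := by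
  simp only [durations, card_filter]
  rw [sum_comm]
  refine sum_congr rfl fun i _ => ?_
  rw [← card_filter, ← Nat.card_Ico, ← card_map Fin.valEmbedding]
  congr 1
  ext s
  simp only [mem_map, mem_filter, mem_Ici, Fin.valEmbedding_apply, mem_Ico, Fin.le_def]
  constructor
  · rintro ⟨r, hr, rfl⟩
    exact hr
  · intro hs
    exact ⟨⟨s, hs.2.trans_le (hh i)⟩, hs, rfl⟩

/-- In an adequate profile, each set of slots carries the demand it cannot avoid. -/
theorem IsAdequate.sum_sub_le {T N : ℕ} {p : Fin T → ℕ} {h : Fin N → ℕ} (hp : IsAdequate p h)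
    (S : Finset (Fin T)) : ∑ i, (h i - (T - S.card)) ≤ ∑ t ∈ S, p t := by
  obtain ⟨A, hrow, hcol⟩ := hp
  calc ∑ i, (h i - (T - S.card)) ≤ ∑ i, ∑ t ∈ S, (if A i t then 1 else 0) := by
        refine sum_le_sum fun i _ => ?_
        have hc : ∑ t ∈ Sᶜ, (if A i t then 1 else 0) ≤ T - S.card := by
          rw [← card_filter]
          exact (card_filter_le _ _).trans_eq (by simp [card_compl])
        have := sum_add_sum_compl S fun t => if A i t then 1 else 0
        rw [hrow i] at this
        omega
    _ = ∑ t ∈ S, ∑ i, (if A i t then 1 else 0) := sum_comm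
    _ ≤ ∑ t ∈ S, p t := sum_le_sum fun t _ => hcol t

/-- If each set of slots can carry the demand it cannot avoid, the supply is adequate. Hall's
theorem is applied to the cells `(i, t)`, each of which takes either one of the `T - h i` idle
tokens of load `i` or one of the `p t` power units of slot `t`. -/
theorem isAdequate_of_sum_sub_le {T N : ℕ} {p : Fin T → ℕ} {h : Fin N → ℕ} (hh : ∀ i, h i ≤ T)
    (hS : ∀ S : Finset (Fin T), ∑ i, (h i - (T - S.card)) ≤ ∑ t ∈ S, p t) :
    IsAdequate p h := by
  classical
  let idle (i : Fin N) : Finset ((Fin N × ℕ) ⊕ (Fin T × ℕ)) :=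
    (range (T - h i)).image fun k => .inl (i, k)
  let power (t : Fin T) : Finset ((Fin N × ℕ) ⊕ (Fin T × ℕ)) :=
    (range (p t)).image fun k => .inr (t, k)
  have idle_card (i) : (idle i).card = T - h i := by
    rw [card_image_of_injective _ fun a b hab => by simpa using hab, card_range]
  have power_card (t) : (power t).card = p t := by
    rw [card_image_of_injective _ fun a b hab => by simpa using hab, card_range]
  have hall : ∀ X : Finset (Fin N × Fin T),
      X.card ≤ (X.biUnion fun x => idle x.1 ∪ power x.2).card := by
    intro X
    set I := X.image Prod.fst
    set S := X.image Prod.snd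
    have hX : X.card ≤ I.card * S.card := by
      rw [← card_product]
      exact card_le_card fun x hx =>
        mem_product.2 ⟨mem_image_of_mem _ hx, mem_image_of_mem _ hx⟩
    have hU : (X.biUnion fun x => idle x.1 ∪ power x.2) = I.biUnion idle ∪ S.biUnion power := by
      rw [image_biUnion, image_biUnion]
      ext y
      simp only [mem_biUnion, mem_union, and_or_left, exists_or]
    have hdisj : Disjoint (I.biUnion idle) (S.biUnion power) := by
      simp only [disjoint_left, mem_biUnion, idle, power, mem_image]
      rintro _ ⟨_, _, _, _, rfl⟩ ⟨_, _, _, _, h'⟩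
      simp at h'
    have hI : (I.biUnion idle).card = ∑ i ∈ I, (T - h i) := by
      rw [card_biUnion]
      · simp only [idle_card]
      · intro i _ j _ hij
        simp only [disjoint_left, idle, mem_image]
        rintro _ ⟨_, _, rfl⟩ ⟨_, _, h'⟩
        simp at h'
        exact hij h'.1.symm
    have hP : (S.biUnion power).card = ∑ t ∈ S, p t := by
      rw [card_biUnion]
      · simp only [power_card]
      · intro i _ j _ hij
        simp only [disjoint_left, power, mem_image]
        rintro _ ⟨_, _, rfl⟩ ⟨_, _, h'⟩
        simp at h'
        exact hij h'.1.symm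
    rw [hU, card_union_of_disjoint hdisj, hI, hP]
    calc X.card ≤ I.card * S.card := hX
      _ = ∑ _i ∈ I, S.card := by simp
      _ ≤ ∑ i ∈ I, ((T - h i) + (h i - (T - S.card))) := by
        refine sum_le_sum fun i _ => ?_
        have := hh i
        have : S.card ≤ T := by simpa using S.card_le_univ
        omega
      _ = ∑ i ∈ I, (T - h i) + ∑ i ∈ I, (h i - (T - S.card)) := sum_add_distrib
      _ ≤ ∑ i ∈ I, (T - h i) + ∑ t ∈ S, p t :=
        Nat.add_le_add_left ((sum_le_sum_of_subset (subset_univ I)).trans (hS S)) _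
  obtain ⟨f, hinj, hf⟩ := (all_card_le_biUnion_card_iff_exists_injective _).1 hall
  have used_le (i : Fin N) : h i ≤ (univ.filter fun t => f (i, t) ∈ power t).card := by
    have hidle : (univ.filter fun t => ¬ f (i, t) ∈ power t).card ≤ (idle i).card := by
      refine card_le_card_of_injOn (fun t => f (i, t)) (fun t ht => ?_) fun t _ r _ htr => ?_
      · exact (mem_union.1 (hf (i, t))).resolve_right (mem_filter.1 ht).2
      · exact congrArg Prod.snd (hinj htr)
    have := card_filter_add_card_filter_not (s := univ) fun t => f (i, t) ∈ power t
    rw [card_univ, Fintype.card_fin] at this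
    have := hh i
    rw [idle_card] at hidle
    omega
  choose B hB hBcard using fun i => exists_subset_card_eq (used_le i)
  refine ⟨fun i t => decide (t ∈ B i), fun i => ?_, fun t => ?_⟩
  · simp [hBcard]
  · rw [← card_filter, ← power_card t]
    refine card_le_card_of_injOn (fun i => f (i, t)) (fun i hi => ?_) fun i _ j _ hij => ?_
    · have hi' : t ∈ B i := by simpa using hi
      exact (mem_filter.1 (hB i hi')).2
    · exact congrArg Prod.fst (hinj hij)

/-- `p` is adequate for `h` iff the demand-duration vector `d` of `h` is weakly
majorized by `p`: every tail sum of `d` is at most the corresponding tail sum of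
the nonincreasing rearrangement `p↓`. -/
theorem adequate_iff_weakly_majorized {T N : ℕ} (p : Fin T → ℕ) (h : Fin N → ℕ)
    (hh : ∀ i, h i ≤ T) :
    IsAdequate p h ↔
      ∀ t : Fin T,
        ∑ s ∈ Ici t, durations (T := T) h s ≤ ∑ s ∈ Ici t, sortedDesc p s := by
  constructor
  · intro hp t
    obtain ⟨A, hcard, hsum, -⟩ := exists_sum_Ici_sortedDesc_eq p t
    have hA := hp.sum_sub_le A
    rwa [hcard, Nat.sub_sub_self t.is_lt.le, ← hsum, ← sum_Ici_durations h hh t] at hA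
  · intro hmaj
    refine isAdequate_of_sum_sub_le hh fun S => ?_
    have hle : S.card ≤ T := by simpa using S.card_le_univ
    rcases S.eq_empty_or_nonempty with rfl | hne
    · simp [Nat.sub_eq_zero_of_le (hh _)]
    · have hpos := hne.card_pos
      let t : Fin T := ⟨T - S.card, by omega⟩
      obtain ⟨A, -, hsum, hmin⟩ := exists_sum_Ici_sortedDesc_eq p t
      have ht := hmaj t
      rw [sum_Ici_durations h hh t, hsum] at ht
      exact ht.trans (hmin S (Nat.sub_sub_self hle).symm)
end

section
/- If the supply profile p = (p_1,…,p_T) ∈ ℕ^T is adequate for the demand profile h = (h_1,…,h_N), then the Least Laxity First allocation rule A satisfies all demands: ∑_{t=1}^T A(i,t) = h_i for every load i, and ∑_{i=1}^N A(i,t) ≤ p_t for every slot t. -/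
open Finset

/-- Number of slots allocated to load `i` strictly before time `t`. -/
def servedBefore {T N : ℕ} (A : Fin N → Fin T → Bool) (i : Fin N) (t : Fin T) : ℕ :=
  ∑ s ∈ Iio t, if A i s then 1 else 0

/-- The laxity of load `i` at (0-indexed) time `t`:
`x_i(t) = (T - t) - (h_i - number of slots already received)`,
i.e. the number of remaining slots minus the remaining demand. -/
def laxity {T N : ℕ} (h : Fin N → ℕ) (A : Fin N → Fin T → Bool)
    (i : Fin N) (t : Fin T) : ℤ :=
  ((T : ℤ) - (t : ℕ)) - ((h i : ℤ) - (servedBefore A i t : ℤ))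

/-- `A` is a Least Laxity First allocation rule for supply `p` and demands `h`:
at each time `t`, only loads with unmet demand are served, the number of loads
served is `min (p t) (#loads with unmet demand)`, and any served load has laxity
no larger than any unserved load with unmet demand. -/
def IsLLF {T N : ℕ} (p : Fin T → ℕ) (h : Fin N → ℕ) (A : Fin N → Fin T → Bool) : Prop :=
  ∀ t : Fin T,
    (∀ i, A i t = true → servedBefore A i t < h i) ∧
    ((∑ i, if A i t then 1 else 0) =
      min (p t) (univ.filter fun i => servedBefore A i t < h i).card) ∧
    (∀ i j, A i t = true → A j t = false → servedBefore A j t < h j →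
      laxity h A i t ≤ laxity h A j t)

/-- The Least Laxity First requirement at the single slot `t`. -/
def IsLLFAt {T N : ℕ} (p : Fin T → ℕ) (h : Fin N → ℕ) (A : Fin N → Fin T → Bool)
    (t : Fin T) : Prop :=
  (∀ i, A i t = true → servedBefore A i t < h i) ∧
    ((∑ i, if A i t then 1 else 0) =
      min (p t) (univ.filter fun i => servedBefore A i t < h i).card) ∧
    (∀ i j, A i t = true → A j t = false → servedBefore A j t < h j →
      laxity h A i t ≤ laxity h A j t)

/-- The allocation `A` meets every demand and respects the supply. -/
def MeetsDemand {T N : ℕ} (p : Fin T → ℕ) (h : Fin N → ℕ) (A : Fin N → Fin T → Bool) : Prop :=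
  (∀ i, (∑ t, if A i t then 1 else 0) = h i) ∧ (∀ t, (∑ i, if A i t then 1 else 0) ≤ p t)

theorem servedBefore_congr {T N : ℕ} {A B : Fin N → Fin T → Bool} {i : Fin N} {t : Fin T}
    (hAB : ∀ s < t, A i s = B i s) : servedBefore A i t = servedBefore B i t :=
  Finset.sum_congr rfl fun s hs => by rw [hAB s (Finset.mem_Iio.1 hs)]

theorem IsLLFAt.congr {T N : ℕ} {p : Fin T → ℕ} {h : Fin N → ℕ} {A B : Fin N → Fin T → Bool}
    {t : Fin T} (hA : IsLLFAt p h A t) (hAB : ∀ i, ∀ s ≤ t, A i s = B i s) : IsLLFAt p h B t := by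
  have hs : ∀ i, servedBefore A i t = servedBefore B i t := fun i =>
    servedBefore_congr fun s hst => hAB i s hst.le
  simpa only [IsLLFAt, laxity, hs, hAB _ t le_rfl] using hA

theorem Finset.exists_subset_card_eq_forall_le {α β : Type*} [DecidableEq α] [LinearOrder β]
    (U : Finset α) (f : α → β) {m : ℕ} (hm : m ≤ U.card) :
    ∃ S ⊆ U, S.card = m ∧ ∀ i ∈ S, ∀ j ∈ U, j ∉ S → f i ≤ f j := by
  induction m with
  | zero => exact ⟨∅, by simp⟩
  | succ m ih =>
    obtain ⟨S, hSU, hcard, hS⟩ := ih (by omega)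
    have hne : (U \ S).Nonempty := by
      rw [← Finset.card_pos, Finset.card_sdiff_of_subset hSU]
      omega
    obtain ⟨a, ha, hmin⟩ := Finset.exists_min_image (U \ S) f hne
    rw [Finset.mem_sdiff] at ha
    refine ⟨insert a S, Finset.insert_subset ha.1 hSU, by simp [ha.2, hcard], ?_⟩
    intro i hi j hj hjS
    rw [Finset.mem_insert, not_or] at hjS
    rcases Finset.mem_insert.1 hi with rfl | hi
    · exact hmin j (Finset.mem_sdiff.2 ⟨hj, hjS.2⟩)
    · exact hS i hi j hj hjS.2

theorem exists_isLLFAt_forall_lt {T N : ℕ} (p : Fin T → ℕ) (h : Fin N → ℕ) (k : ℕ) :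
    ∃ A : Fin N → Fin T → Bool, ∀ t : Fin T, (t : ℕ) < k → IsLLFAt p h A t := by
  induction k with
  | zero => exact ⟨fun _ _ => false, by simp⟩
  | succ k ih =>
    obtain ⟨A, hA⟩ := ih
    by_cases hk : k < T
    · set t : Fin T := ⟨k, hk⟩
      obtain ⟨S, hSU, hcard, hS⟩ := Finset.exists_subset_card_eq_forall_le
        (univ.filter fun i => servedBefore A i t < h i) (fun i => laxity h A i t)
        (Nat.min_le_right (p t) _)
      set B : Fin N → Fin T → Bool := fun i s => if s = t then decide (i ∈ S) else A i s with hB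
      have hBA : ∀ i, ∀ s < t, A i s = B i s := fun i s hs => by simp [hB, hs.ne]
      refine ⟨B, fun s hs => ?_⟩
      rcases Nat.lt_succ_iff_lt_or_eq.1 hs with hs | hs
      · exact (hA s hs).congr fun i u hu => hBA i u (lt_of_le_of_lt hu hs)
      · rw [show s = t from Fin.ext hs]
        have hsv : ∀ i, servedBefore B i t = servedBefore A i t := fun i =>
          (servedBefore_congr (hBA i)).symm
        have hBs : ∀ i, B i t = decide (i ∈ S) := fun i => by simp [hB]
        refine ⟨fun i hi => ?_, ?_, fun i j hi hj hlt => ?_⟩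
        · rw [hsv]
          exact (Finset.mem_filter.1 (hSU (by simpa [hBs] using hi))).2
        · simpa [hBs, hsv] using hcard
        · simp only [laxity, hsv]
          exact hS i (by simpa [hBs] using hi) j (by simpa [hsv] using hlt)
            (by simpa [hBs] using hj)
    · exact ⟨A, fun t _ => hA t (by omega)⟩

theorem sum_eq_servedBefore_add {T N : ℕ} (A : Fin N → Fin T → Bool) (i : Fin N) (t : Fin T) :
    (∑ s, if A i s then 1 else 0) =
      servedBefore A i t + (if A i t then 1 else 0) + ∑ s ∈ Ioi t, if A i s then 1 else 0 := by
  have hu : (univ : Finset (Fin T)) = Iio t ∪ ({t} ∪ Ioi t) := by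
    ext s
    simp only [mem_univ, mem_union, mem_Iio, mem_singleton, mem_Ioi, true_iff]
    exact lt_trichotomy s t
  rw [hu, Finset.sum_union, Finset.sum_union, Finset.sum_singleton, servedBefore, add_assoc]
  · simp
  · rw [Finset.disjoint_left]
    intro s
    simp only [mem_Iio, mem_union, mem_singleton, mem_Ioi]
    omega

/-- Loads `i` and `j` trade the slots `s` and `t`. -/
theorem MeetsDemand.trade {T N : ℕ} {p : Fin T → ℕ} {h : Fin N → ℕ} {B : Fin N → Fin T → Bool}
    (hB : MeetsDemand p h B) {i j : Fin N} {s t : Fin T} (hit : B i t = false)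
    (his : B i s = true) (hjt : B j t = true) (hjs : B j s = false) :
    MeetsDemand p h fun k u => if k = i ∨ k = j then B k (Equiv.swap s t u) else B k u := by
  refine ⟨fun k => ?_, fun u => ?_⟩
  · rw [← hB.1 k]
    by_cases hk : k = i ∨ k = j
    · simp only [hk, if_true]
      exact Equiv.sum_comp (Equiv.swap s t) fun u => if B k u then 1 else 0
    · simp only [hk, if_false]
  · refine le_trans (le_of_eq ?_) (hB.2 u)
    by_cases hu : u = s ∨ u = t
    · rw [← Equiv.sum_comp (Equiv.swap i j) fun k => if B k u then 1 else 0]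
      refine Finset.sum_congr rfl fun k _ => ?_
      grind
    · refine Finset.sum_congr rfl fun k _ => ?_
      grind

/-- Load `i` moves from slot `s` to slot `t`, which has spare supply. -/
theorem MeetsDemand.move {T N : ℕ} {p : Fin T → ℕ} {h : Fin N → ℕ} {B : Fin N → Fin T → Bool}
    (hB : MeetsDemand p h B) {i : Fin N} {s t : Fin T} (hit : B i t = false)
    (hlt : (∑ k, if B k t then 1 else 0) < p t) :
    MeetsDemand p h fun k u => if k = i then B k (Equiv.swap s t u) else B k u := by
  refine ⟨fun k => ?_, fun u => ?_⟩
  · rw [← hB.1 k]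
    by_cases hk : k = i
    · simp only [hk, if_true]
      exact Equiv.sum_comp (Equiv.swap s t) fun u => if B i u then 1 else 0
    · simp only [hk, if_false]
  · by_cases hu : u = t
    · subst hu
      refine le_trans ?_ (Nat.succ_le_of_lt hlt)
      have hone : (∑ k, if k = i then 1 else 0) = 1 := by simp
      rw [Nat.succ_eq_add_one, ← hone, ← Finset.sum_add_distrib]
      refine Finset.sum_le_sum fun k _ => ?_
      grind
    · refine le_trans (Finset.sum_le_sum fun k _ => ?_) (hB.2 u)
      grind

/-- If `A` serves `i` at slot `t` but the feasible allocation `B` does not, then `B` can be made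
to serve `i` as well, keeping every load on which `B` and `A` already agree at `t`. -/
theorem MeetsDemand.exists_exchange {T N : ℕ} {p : Fin T → ℕ} {h : Fin N → ℕ}
    {A B : Fin N → Fin T → Bool} {t : Fin T} (hA : IsLLFAt p h A t) (hB : MeetsDemand p h B)
    (hAB : ∀ k, ∀ s < t, B k s = A k s) {i : Fin N} (hAi : A i t = true) (hBi : B i t = false) :
    ∃ B', MeetsDemand p h B' ∧ (∀ k, ∀ s < t, B' k s = A k s) ∧ B' i t = A i t ∧
      ∀ k, B k t = A k t → B' k t = A k t := by
  obtain ⟨hA₁, hA₂, hA₃⟩ := hA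
  have hsv : ∀ k, servedBefore B k t = servedBefore A k t := fun k => servedBefore_congr (hAB k)
  have hsum : ∀ k, servedBefore A k t + (if B k t then 1 else 0) +
      ∑ s ∈ Ioi t, (if B k s then 1 else 0) = h k := fun k => by
    rw [← hsv, ← sum_eq_servedBefore_add, hB.1]
  have hi := hsum i
  have hi' := hA₁ i hAi
  simp only [hBi, Bool.false_eq_true, if_false] at hi
  by_cases hj : ∃ j, B j t = true ∧ A j t = false
  · obtain ⟨j, hBj, hAj⟩ := hj
    have hj := hsum j
    simp only [hBj, if_true] at hj
    have hlax := hA₃ i j hAi hAj (by omega)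
    simp only [laxity] at hlax
    obtain ⟨s, hs, hlt⟩ := Finset.exists_lt_of_sum_lt
      (s := Ioi t) (f := fun s => if B j s then 1 else 0) (g := fun s => if B i s then 1 else 0)
      (by omega)
    have hs := Finset.mem_Ioi.1 hs
    have hst : B i s = true ∧ B j s = false := by grind
    refine ⟨_, hB.trade hBi hst.1 hBj hst.2, ?_, ?_, ?_⟩ <;> grind
  · obtain ⟨s, hs, hlt⟩ := Finset.exists_lt_of_sum_lt
      (s := Ioi t) (f := fun _ => 0) (g := fun s => if B i s then 1 else 0)
      (by simp only [Finset.sum_const_zero]; omega)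
    have hs := Finset.mem_Ioi.1 hs
    have his : B i s = true := by grind
    have hlt : (∑ k, if B k t then 1 else 0) < p t := by
      refine lt_of_lt_of_le (Finset.sum_lt_sum (g := fun k => if A k t then 1 else 0)
        (fun k _ => ?_) ⟨i, mem_univ i, ?_⟩) (hA₂.trans_le (min_le_left _ _)) <;> grind
    refine ⟨_, hB.move (s := s) hBi hlt, ?_, ?_, ?_⟩ <;> grind

theorem MeetsDemand.eq_of_forall_imp {T N : ℕ} {p : Fin T → ℕ} {h : Fin N → ℕ}
    {A B : Fin N → Fin T → Bool} {t : Fin T} (hA : IsLLFAt p h A t) (hB : MeetsDemand p h B)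
    (hAB : ∀ k, ∀ s < t, B k s = A k s) (himp : ∀ k, A k t = true → B k t = true) (k : Fin N) :
    B k t = A k t := by
  have hle : (∑ k, if B k t then 1 else 0) ≤ ∑ k, if A k t then 1 else 0 := by
    rw [hA.2.1]
    refine le_min (hB.2 t) ?_
    rw [← Finset.card_filter]
    refine Finset.card_le_card fun k hk => ?_
    have hBk : B k t = true := by simpa using hk
    have hsum := hB.1 k
    rw [sum_eq_servedBefore_add B k t, servedBefore_congr (hAB k)] at hsum
    simp only [hBk, if_true] at hsum
    simp only [mem_filter, mem_univ, true_and]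
    omega
  by_contra hne
  refine hle.not_gt (Finset.sum_lt_sum (fun k _ => ?_) ⟨k, mem_univ k, ?_⟩) <;> grind

theorem MeetsDemand.exists_agree_at {T N : ℕ} {p : Fin T → ℕ} {h : Fin N → ℕ}
    {A B : Fin N → Fin T → Bool} {t : Fin T} (hA : IsLLFAt p h A t) (hB : MeetsDemand p h B)
    (hAB : ∀ k, ∀ s < t, B k s = A k s) :
    ∃ B', MeetsDemand p h B' ∧ ∀ k, ∀ s ≤ t, B' k s = A k s := by
  induction hn : (univ.filter fun k => B k t ≠ A k t).card using Nat.strong_induction_on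
    generalizing B with
  | _ n ih =>
    by_cases himp : ∀ k, A k t = true → B k t = true
    · refine ⟨B, hB, fun k s hs => ?_⟩
      rcases hs.lt_or_eq with hs | rfl
      · exact hAB k s hs
      · exact hB.eq_of_forall_imp hA hAB himp k
    · push Not at himp
      obtain ⟨i, hAi, hBi⟩ := himp
      obtain ⟨B', hB', hAB', hi, hk⟩ := hB.exists_exchange hA hAB hAi (by simpa using hBi)
      refine ih _ ?_ hB' hAB' rfl
      rw [← hn]
      refine Finset.card_lt_card (Finset.ssubset_iff_subset_ne.2 ⟨fun k => ?_, fun heq => ?_⟩)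
      · simpa using mt (hk k)
      · have := Finset.ext_iff.1 heq i
        simp [hi, hAi, hBi] at this

theorem IsLLF.meetsDemand {T N : ℕ} {p : Fin T → ℕ} {h : Fin N → ℕ} {A : Fin N → Fin T → Bool}
    (hA : IsLLF p h A) (hp : IsAdequate p h) : MeetsDemand p h A := by
  have key : ∀ n : ℕ, ∃ B, MeetsDemand p h B ∧ ∀ k, ∀ s : Fin T, (s : ℕ) < n → B k s = A k s := by
    intro n
    induction n with
    | zero =>
      obtain ⟨B, hB⟩ := hp
      exact ⟨B, hB, by simp⟩
    | succ n ih =>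
      obtain ⟨B, hB, hAB⟩ := ih
      by_cases hn : n < T
      · obtain ⟨B', hB', hAB'⟩ := hB.exists_agree_at (t := ⟨n, hn⟩) (hA _)
          fun k s hs => hAB k s hs
        exact ⟨B', hB', fun k s hs => hAB' k s (Nat.lt_succ_iff.1 hs)⟩
      · exact ⟨B, hB, fun k s _ => hAB k s (by omega)⟩
  obtain ⟨B, hB, hAB⟩ := key T
  obtain rfl : B = A := funext fun k => funext fun s => hAB k s s.isLt
  exact hB

/-- An LLF allocation rule always exists, and if the supply profile `p` is
adequate for the demand profile `h`, then any Least Laxity First allocation rule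
satisfies all the demands: load `i` receives exactly `h i` slots, and at most
`p t` units of power are used in slot `t`. -/
theorem llf_satisfies_all_demands {T N : ℕ} (p : Fin T → ℕ) (h : Fin N → ℕ)
    (hh : ∀ i, h i ≤ T) :
    (∃ A : Fin N → Fin T → Bool, IsLLF p h A) ∧
    (IsAdequate p h →
      ∀ A : Fin N → Fin T → Bool, IsLLF p h A →
        (∀ i, (∑ t, if A i t then 1 else 0) = h i) ∧
        (∀ t, (∑ i, if A i t then 1 else 0) ≤ p t)) := by
  obtain ⟨A, hA⟩ := exists_isLLFAt_forall_lt p h T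
  exact ⟨⟨A, fun t => hA t t.isLt⟩, fun hp A hA => hA.meetsDemand hp⟩
end

section
/- Fix a nonincreasing vector d ∈ ℕ^T and a supply profile p ∈ ℕ^T. The minimum of ∑_{t=1}^T a_t over all vectors a ∈ ℕ^T (a ≥ 0) such that d ⪯^w (p + a) equals max_{1≤t≤T} ( ∑_{s=t}^T (d_s − p↓_s) )^+, where x^+ = max(x,0). Consequently, for a unit price c ≥ 0 of supplemental power, the minimum cost of making the supply adequate is c · max_{1≤t≤T} ( ∑_{s=t}^T (d_s − p↓_s) )^+. -/
open Finset

/-- Final segments minimize the sum of an antitone function among sets of a given size. -/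
theorem sum_Ici_le_sum_of_antitone {T : ℕ} {f : Fin T → ℕ} (hf : Antitone f) (t : Fin T)
    {S : Finset (Fin T)} (hS : S.card = (Ici t).card) :
    ∑ s ∈ Ici t, f s ≤ ∑ s ∈ S, f s := by
  have h1 : ∑ s ∈ Ici t \ S, f s ≤ (Ici t \ S).card • f t :=
    sum_le_card_nsmul _ _ _ fun s hs => hf (by simp only [mem_sdiff, mem_Ici] at hs; exact hs.1)
  have h2 : (S \ Ici t).card • f t ≤ ∑ s ∈ S \ Ici t, f s :=
    card_nsmul_le_sum _ _ _ fun s hs => hf (by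
      simp only [mem_sdiff, mem_Ici, not_le] at hs; exact hs.2.le)
  have h3 : (S \ Ici t).card = (Ici t \ S).card := card_sdiff_comm hS
  rw [← sum_inter_add_sum_sdiff (Ici t) S f, ← sum_inter_add_sum_sdiff S (Ici t) f,
    inter_comm S]
  rw [h3] at h2
  exact Nat.add_le_add_left (h1.trans h2) _

theorem sortedDesc_antitone {T : ℕ} (a : Fin T → ℕ) : Antitone (sortedDesc a) :=
  fun _ _ h => Tuple.monotone_sort a (Fin.rev_le_rev.2 h)

/-- A tail sum of the nonincreasing rearrangement is attained by some set of indices. -/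
theorem exists_sum_eq_sum_sortedDesc {T : ℕ} (a : Fin T → ℕ) (t : Fin T) :
    ∃ S : Finset (Fin T), S.card = T - t ∧
      ∀ b : Fin T → ℕ, ∑ s ∈ S, b s = ∑ s ∈ Ici t, b (Tuple.sort a s.rev) := by
  refine ⟨(Ici t).map (Fin.revPerm.trans (Tuple.sort a)).toEmbedding, by simp, fun b => ?_⟩
  simp

/-- A tail sum of the nonincreasing rearrangement is minimal among sums over sets of the
same size. -/
theorem sum_sortedDesc_le {T : ℕ} (a : Fin T → ℕ) (t : Fin T) {S : Finset (Fin T)}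
    (hS : S.card = T - t) : ∑ s ∈ Ici t, sortedDesc a s ≤ ∑ s ∈ S, a s := by
  have h := sum_Ici_le_sum_of_antitone (sortedDesc_antitone a) t
    (S := S.map (Fin.revPerm.trans (Tuple.sort a)).symm.toEmbedding) (by simp [hS])
  simpa [sortedDesc] using h

/-- Greedy filling: always raising a minimal entry of `p` removes a deficit of `M` with
`M` units. -/
theorem exists_fill {ι : Type*} [Fintype ι] [DecidableEq ι] [Nonempty ι] {e : ℕ → ℕ}
    (he : Monotone e) (M : ℕ) (p : ι → ℕ)
    (h : ∀ S : Finset ι, ∑ k ∈ range S.card, e k ≤ ∑ s ∈ S, p s + M) :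
    ∃ a : ι → ℕ, ∑ s, a s = M ∧
      ∀ S : Finset ι, ∑ k ∈ range S.card, e k ≤ ∑ s ∈ S, (p s + a s) := by
  induction M generalizing p with
  | zero => exact ⟨0, by simp, by simpa using h⟩
  | succ M ih =>
    obtain ⟨i, hi⟩ := Finite.exists_min p
    obtain ⟨a, ha, hpa⟩ := ih (fun s => p s + if s = i then 1 else 0) (by
      intro S
      rw [sum_add_distrib, sum_ite_eq']
      split_ifs with hS
      · have := h S
        omega
      · by_contra! hlt
        have h1 := h (insert i S)
        rw [card_insert_of_notMem hS, sum_range_succ, sum_insert hS] at h1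
        have h2 : ∑ k ∈ range S.card, e k ≤ S.card * p i := by
          simpa using sum_le_card_nsmul (range S.card) e (p i) fun k hk =>
            (he (mem_range.1 hk).le).trans (by omega)
        have h3 : S.card * p i ≤ ∑ s ∈ S, p s := by
          simpa using card_nsmul_le_sum S p (p i) fun s _ => hi s
        omega)
    refine ⟨fun s => (if s = i then 1 else 0) + a s, ?_, fun S => ?_⟩
    · rw [sum_add_distrib, ha]
      simp [add_comm]
    · simpa only [add_assoc] using hpa S

theorem sum_Ici_eq_sum_range {T : ℕ} (hT : 0 < T) (d : Fin T → ℕ) (t : Fin T) :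
    ∑ s ∈ Ici t, d s = ∑ k ∈ range (T - t), d ⟨T - 1 - k, by omega⟩ := by
  refine sum_bij' (fun s _ => T - 1 - s) (fun k _ => ⟨T - 1 - k, by omega⟩) ?_ ?_ ?_ ?_ ?_
  · intro s hs
    have := Fin.le_def.1 (mem_Ici.1 hs)
    have := s.2
    exact mem_range.2 (by omega)
  · intro k hk
    have := mem_range.1 hk
    exact mem_Ici.2 (Fin.le_def.2 (by simp only; omega))
  · intro s _
    ext
    simp only
    omega
  · intro k hk
    have := mem_range.1 hk
    simp only
    omega
  · intro s _
    congr 1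
    ext
    simp only
    omega

/-- The minimum of `∑ a_t` over supplemental purchase vectors `a ∈ ℕ^T` making the
supply `p + a` weakly majorize the nonincreasing demand-duration vector `d` equals
`max_{1 ≤ t ≤ T} (∑_{s=t}^T (d_s − p↓_s))⁺`; consequently, for any unit price
`c ≥ 0`, the minimum cost `c·∑ a_t` equals `c` times that quantity. -/
theorem min_supplemental_power {T : ℕ} (hT : 0 < T) (d p : Fin T → ℕ)
    (hd : Antitone d) :
    IsLeast
      {n : ℕ | ∃ a : Fin T → ℕ,
        (∀ t : Fin T,
          ∑ s ∈ Ici t, d s ≤ ∑ s ∈ Ici t, sortedDesc (fun u => p u + a u) s) ∧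
        n = ∑ t, a t}
      (univ.sup' ⟨⟨0, hT⟩, mem_univ _⟩
        (fun t : Fin T =>
          max 0 (∑ s ∈ Ici t, ((d s : ℤ) - (sortedDesc p s : ℤ))))).toNat ∧
    ∀ c : ℝ, 0 ≤ c →
      IsLeast
        {x : ℝ | ∃ a : Fin T → ℕ,
          (∀ t : Fin T,
            ∑ s ∈ Ici t, d s ≤ ∑ s ∈ Ici t, sortedDesc (fun u => p u + a u) s) ∧
          x = c * ∑ t, (a t : ℝ)}
        (c * (univ.sup' ⟨⟨0, hT⟩, mem_univ _⟩
          (fun t : Fin T =>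
            max 0 (∑ s ∈ Ici t, ((d s : ℤ) - (sortedDesc p s : ℤ))))).toNat) := by
  set M := (univ.sup' ⟨⟨0, hT⟩, mem_univ _⟩
    (fun t : Fin T => max 0 (∑ s ∈ Ici t, ((d s : ℤ) - (sortedDesc p s : ℤ))))).toNat
  have hMle : ∀ n : ℕ, M ≤ n ↔
      ∀ t : Fin T, ∑ s ∈ Ici t, d s ≤ ∑ s ∈ Ici t, sortedDesc p s + n := by
    intro n
    refine Int.toNat_le.trans ((sup'_le_iff _ _).trans (forall_congr' fun t => ?_))
    rw [sum_sub_distrib, ← Nat.cast_sum, ← Nat.cast_sum]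
    simp only [mem_univ, true_imp_iff]
    omega
  have lower : ∀ a : Fin T → ℕ,
      (∀ t : Fin T,
        ∑ s ∈ Ici t, d s ≤ ∑ s ∈ Ici t, sortedDesc (fun u => p u + a u) s) →
      M ≤ ∑ t, a t := by
    refine fun a ha => (hMle _).2 fun t => (ha t).trans ?_
    obtain ⟨S, hS, hSp⟩ := exists_sum_eq_sum_sortedDesc p t
    calc _ ≤ ∑ s ∈ S, (p s + a s) := sum_sortedDesc_le _ t hS
      _ = ∑ s ∈ Ici t, sortedDesc p s + ∑ s ∈ S, a s := by
        rw [sum_add_distrib, hSp p]; rfl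
      _ ≤ _ := Nat.add_le_add_left (sum_le_sum_of_subset (subset_univ S)) _
  obtain ⟨a, haM, ha⟩ : ∃ a : Fin T → ℕ, ∑ t, a t = M ∧ ∀ t : Fin T,
      ∑ s ∈ Ici t, d s ≤ ∑ s ∈ Ici t, sortedDesc (fun u => p u + a u) s := by
    have : Nonempty (Fin T) := ⟨⟨0, hT⟩⟩
    have he : Monotone fun k : ℕ => d ⟨T - 1 - k, by omega⟩ :=
      fun j k hjk => hd (Fin.le_def.2 (by simp only; omega))
    obtain ⟨a, haM, ha⟩ := exists_fill he M p (by
      intro S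
      rcases Nat.eq_zero_or_pos S.card with h0 | hpos
      · simp [h0]
      · have hcard : S.card ≤ T := by simpa using card_le_univ S
        have hS : S.card = T - (⟨T - S.card, by omega⟩ : Fin T) := by
          simp only
          omega
        have h := (hMle M).1 le_rfl ⟨T - S.card, by omega⟩
        rw [sum_Ici_eq_sum_range hT, ← hS] at h
        exact h.trans (Nat.add_le_add_right (sum_sortedDesc_le p _ hS) _))
    refine ⟨a, haM, fun t => ?_⟩
    obtain ⟨S, hS, hSp⟩ := exists_sum_eq_sum_sortedDesc (fun u => p u + a u) t
    have h := ha S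
    rw [hS, ← sum_Ici_eq_sum_range hT, hSp fun u => p u + a u] at h
    exact h
  refine ⟨⟨⟨a, ha, haM.symm⟩, ?_⟩, fun c hc => ⟨⟨a, ha, ?_⟩, ?_⟩⟩
  · rintro n ⟨b, hb, rfl⟩
    exact lower b hb
  · rw [← haM, Nat.cast_sum]
  · rintro x ⟨b, hb, rfl⟩
    rw [← Nat.cast_sum]
    exact mul_le_mul_of_nonneg_left (Nat.cast_le.2 (lower b hb)) hc
end

section
/- (Social welfare, concave utility.) Suppose r ∈ ℕ^T is nonincreasing (r = r↓), U : {0,1,…,T} → ℝ satisfies U(0) = 0 and has nonnegative, nonincreasing increments (U(h) − U(h−1) is nonnegative and nonincreasing in h), the number of consumers N exceeds ∑_{t=1}^T r_t, and c ≥ 0 is the unit price of purchased power. Define k* = max{ k ∈ {1,…,T} : U(k) − U(k−1) ≥ c } if this set is nonempty, and k* = 0 otherwise. Then the social welfare problem — maximize ∑_{i=1}^N U(h_i) − c ∑_{t=1}^T y_t over demand profiles h ∈ {0,…,T}^N and purchase vectors y ∈ ℕ^T subject to d ⪯^w (r + y), where d_t = #{i : h_i ≥ t} — attains its maximum at a solution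 whose demand-duration vector is d* given by: if k* ≥ 1, d*_t = N for t ≤ k* and d*_t = 0 for t > k*; and if k* = 0, d*_1 = ∑_{t=1}^T r_t and d*_t = 0 for t > 1; in each case with y a minimizer of ∑_t y_t over {y ∈ ℕ^T : d* ⪯^w (r + y)}. -/
open Finset

/-- Weak majorization `d ⪯^w p` for a nonincreasing `d`: every tail sum of `d`
is at most the corresponding tail sum of the nonincreasing rearrangement `p↓`
(this is adequacy of the supply `p` for the demand-duration vector `d`). -/
def MajW {T : ℕ} (d p : Fin T → ℕ) : Prop :=
  ∀ t : Fin T, ∑ s ∈ Ici t, d s ≤ ∑ s ∈ Ici t, sortedDesc p s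

theorem sortedDesc_eq_self {T : ℕ} {p : Fin T → ℕ} (hp : Antitone p) : sortedDesc p = p := by
  have hmono : Monotone (p ∘ (Fin.revPerm : Equiv.Perm (Fin T))) := fun a b hab =>
    hp (Fin.rev_le_rev.mpr hab)
  have h := Tuple.comp_sort_eq_comp_iff_monotone.mpr hmono
  funext t
  have ht := congrFun h t.rev
  simpa [sortedDesc] using ht.symm

theorem MajW.sum_le {T : ℕ} {d p : Fin T → ℕ} (hT : 0 < T) (h : MajW d p) :
    ∑ t, d t ≤ ∑ t, p t := by
  have hIci : Ici (⟨0, hT⟩ : Fin T) = univ := by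
    ext s
    simp [Fin.le_def]
  have h0 := h ⟨0, hT⟩
  rwa [hIci, sum_sortedDesc] at h0

/-- For a nonincreasing supply, adequacy follows from equality of the totals and domination of
the supply by the demand on all initial segments preceding the support of the demand. -/
theorem majW_of_antitone {T : ℕ} {d p : Fin T → ℕ} (hp : Antitone p)
    (hsum : ∑ t, d t ≤ ∑ t, p t)
    (hle : ∀ t, (∀ s, t ≤ s → d s = 0) ∨ ∀ s < t, p s ≤ d s) : MajW d p := by
  intro t
  rw [sortedDesc_eq_self hp]
  rcases hle t with h | h
  · rw [sum_eq_zero fun s hs => h s (mem_Ici.mp hs)]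
    exact Nat.zero_le _
  · have hcompl : (Ici t)ᶜ = Iio t := by
      ext s
      simp
    have hd := sum_add_sum_compl (Ici t) d
    have hq := sum_add_sum_compl (Ici t) p
    rw [hcompl] at hd hq
    have hlt : ∑ s ∈ Iio t, p s ≤ ∑ s ∈ Iio t, d s :=
      sum_le_sum fun s hs => h s (mem_Iio.mp hs)
    omega

theorem sum_durations {T N : ℕ} {h : Fin N → ℕ} (hh : ∀ i, h i ≤ T) :
    ∑ t, durations (T := T) h t = ∑ i, h i := by
  simp only [durations, card_filter]
  rw [sum_comm]
  refine sum_congr rfl fun i _ => ?_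
  rw [Fin.sum_univ_eq_sum_range (fun t => if t < h i then 1 else 0) T, ← card_filter]
  have : (range T).filter (fun t => t < h i) = range (h i) := by
    ext t
    have := hh i
    simp only [mem_filter, mem_range]
    omega
  rw [this, card_range]

theorem increment_antitone {T : ℕ} {U : ℕ → ℝ}
    (hU : ∀ k : ℕ, k + 2 ≤ T → U (k + 2) - U (k + 1) ≤ U (k + 1) - U k)
    {i j : ℕ} (hij : i ≤ j) (hj : j < T) : U (j + 1) - U j ≤ U (i + 1) - U i := by
  induction j, hij using Nat.le_induction with
  | base => exact le_rfl
  | succ j _ ih => exact (hU j hj).trans (ih (by omega))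

/-- With nonincreasing increments, net utility `U j - c * j` is maximal at the last index whose
increment is at least `c`. -/
theorem net_utility_le {T : ℕ} {U : ℕ → ℝ} {c : ℝ}
    (hU : ∀ k : ℕ, k + 2 ≤ T → U (k + 2) - U (k + 1) ≤ U (k + 1) - U k)
    {k : ℕ} (hk : 1 ≤ k) (hkT : k ≤ T) (hck : c ≤ U k - U (k - 1))
    (hmax : ∀ j, k < j → j ≤ T → ¬ c ≤ U j - U (j - 1)) {j : ℕ} (hj : j ≤ T) :
    U j - c * j ≤ U k - c * k := by
  rcases le_total j k with hjk | hkj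
  · have hstep : ∀ m, j ≤ m → m ≤ k → U j - c * j ≤ U m - c * m := by
      intro m hjm
      induction m, hjm using Nat.le_induction with
      | base => exact fun _ => le_rfl
      | succ m _ ih =>
        intro hm
        have h1 := ih (by omega)
        have h2 := increment_antitone hU (i := m) (j := k - 1) (by omega) (by omega)
        rw [Nat.sub_add_cancel hk] at h2
        push_cast
        linarith
    exact hstep k hjk le_rfl
  · induction j, hkj using Nat.le_induction with
    | base => exact le_rfl
    | succ j hkj ih =>
      have h1 := ih (by omega)
      have h2 := hmax (j + 1) (by omega) hj
      rw [Nat.add_sub_cancel] at h2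
      push_cast
      linarith

theorem utility_le_mul {T : ℕ} {U : ℕ → ℝ} (hU0 : U 0 = 0)
    (hU : ∀ k : ℕ, k + 2 ≤ T → U (k + 2) - U (k + 1) ≤ U (k + 1) - U k)
    {j : ℕ} (hj : j ≤ T) : U j ≤ U 1 * j := by
  induction j with
  | zero => simp [hU0]
  | succ j ih =>
    have h1 := ih (by omega)
    have h2 := increment_antitone hU (Nat.zero_le j) hj
    rw [zero_add, hU0] at h2
    push_cast
    linarith

/-- If the total of a nonincreasing `r` is less than `N`, the demand asking for `N` units in
the slots up to `m` is met by a purchase that wastes nothing. -/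
theorem exists_purchase {T N : ℕ} {r : Fin T → ℕ} (hr : Antitone r) (hN : ∑ t, r t < N)
    (m : Fin T) {d : Fin T → ℕ} (hd : ∀ t, d t = if t ≤ m then N else 0) :
    ∃ y : Fin T → ℕ, MajW d (fun t => r t + y t) ∧ ∑ t, r t + ∑ t, y t = ∑ t, d t := by
  obtain ⟨R, hR⟩ : ∃ R, R = ∑ s ∈ Ioi m, r s := ⟨_, rfl⟩
  have hrR : ∀ s ≤ m, r s + R < N := by
    intro s hs
    have hnot : s ∉ Ioi m := by simpa using hs
    have := sum_le_sum_of_subset (f := r) (subset_univ (insert s (Ioi m)))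
    rw [sum_insert hnot] at this
    omega
  obtain ⟨p, hp⟩ : ∃ p : Fin T → ℕ,
      p = fun s => if s < m then N else if s = m then N - R else r s := ⟨_, rfl⟩
  have hrp : ∀ s, r s ≤ p s := by
    intro s
    have := hrR s
    rw [hp]
    dsimp only
    split_ifs <;> grind
  have hanti : Antitone p := by
    intro a b hab
    have h1 := hr hab
    have h2 := hrR m le_rfl
    have h3 := @hr m b
    rw [hp]
    dsimp only
    grind
  have hsum : ∑ s, p s = ∑ s, d s := by
    have hpt : ∀ s, p s + (if s = m then R else 0) = d s + if m < s then r s else 0 := by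
      intro s
      have h2 := hrR m le_rfl
      rw [hp, hd]
      dsimp only
      grind
    have htot := sum_congr (rfl : (univ : Finset (Fin T)) = univ) fun s _ => hpt s
    rw [sum_add_distrib, sum_add_distrib, ← sum_filter (fun s => m < s)] at htot
    have hfil : univ.filter (fun s => m < s) = Ioi m := by
      ext s
      simp
    rw [hfil, ← hR] at htot
    simpa using htot
  have hry : (fun t => r t + (p t - r t)) = p := funext fun t => Nat.add_sub_cancel' (hrp t)
  refine ⟨fun t => p t - r t, ?_, ?_⟩
  · rw [hry]
    refine majW_of_antitone hanti hsum.ge fun t => ?_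
    rcases lt_or_ge m t with hmt | htm
    · left
      intro s hs
      rw [hd, if_neg (not_le.mpr (hmt.trans_le hs))]
    · right
      intro s hs
      have hsm := hs.trans_le htm
      rw [hd, if_pos hsm.le, hp]
      simp [hsm]
  · rw [← sum_add_distrib, hry, hsum]

/-- Social welfare maximization with concave utility: with `r` nonincreasing, `U`
having nonnegative nonincreasing increments on `{0,…,T}`, `N > ∑ r_t`, price `c ≥ 0`,
and `k* = max{k ∈ {1,…,T} : U(k)−U(k−1) ≥ c}` (`k* = 0` if none), the social
welfare problem attains its maximum at a solution whose demand-duration vector is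
`d*`, where `d*_t = N` for `t ≤ k*` and `d*_t = 0` for `t > k*` (1-indexed) if
`k* ≥ 1`, and `d*_1 = ∑ r_t`, `d*_t = 0` for `t > 1` if `k* = 0`, together with a
`y` minimizing `∑ y_t` subject to `d* ⪯^w (r + y)`. -/
theorem social_welfare_concave {T N : ℕ} (hT : 0 < T)
    (r : Fin T → ℕ) (hr : Antitone r)
    (U : ℕ → ℝ) (hU0 : U 0 = 0)
    (hUpos : ∀ k : ℕ, k < T → U k ≤ U (k + 1))
    (hUconc : ∀ k : ℕ, k + 2 ≤ T → U (k + 2) - U (k + 1) ≤ U (k + 1) - U k)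
    (c : ℝ) (hc : 0 ≤ c)
    (hN : ∑ t, r t < N)
    (kstar : ℕ)
    (hk1 : (∃ k, 1 ≤ k ∧ k ≤ T ∧ c ≤ U k - U (k - 1)) →
      1 ≤ kstar ∧ kstar ≤ T ∧ c ≤ U kstar - U (kstar - 1) ∧
        ∀ j, kstar < j → j ≤ T → ¬ c ≤ U j - U (j - 1))
    (hk2 : (¬ ∃ k, 1 ≤ k ∧ k ≤ T ∧ c ≤ U k - U (k - 1)) → kstar = 0)
    (dstar : Fin T → ℕ)
    (hd1 : 1 ≤ kstar → ∀ t : Fin T, dstar t = if (t : ℕ) < kstar then N else 0)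
    (hd2 : kstar = 0 → ∀ t : Fin T, dstar t = if (t : ℕ) = 0 then ∑ s, r s else 0) :
    ∃ (hstar : Fin N → ℕ) (ystar : Fin T → ℕ),
      (∀ i, hstar i ≤ T) ∧
      -- the optimal demand profile has demand-duration vector `d*`
      (∀ t : Fin T, durations (T := T) hstar t = dstar t) ∧
      -- `ystar` is feasible and minimizes total purchase for `d*`
      MajW dstar (fun t => r t + ystar t) ∧
      (∀ y : Fin T → ℕ, MajW dstar (fun t => r t + y t) →
        ∑ t, ystar t ≤ ∑ t, y t) ∧
      -- `(hstar, ystar)` maximizes social welfare among all feasible `(h, y)`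
      (∀ (h : Fin N → ℕ) (y : Fin T → ℕ), (∀ i, h i ≤ T) →
        MajW (durations (T := T) h) (fun t => r t + y t) →
        ∑ i, U (h i) - c * ∑ t, (y t : ℝ) ≤
          ∑ i, U (hstar i) - c * ∑ t, (ystar t : ℝ)) := by
  rcases Nat.eq_zero_or_pos kstar with hk | hk
  · have hnone : ¬ ∃ k, 1 ≤ k ∧ k ≤ T ∧ c ≤ U k - U (k - 1) := fun h => by
      have := (hk1 h).1
      omega
    have hU1c : U 1 < c := by
      by_contra! h
      exact hnone ⟨1, le_rfl, hT, by simpa [hU0] using h⟩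
    have hU1 : 0 ≤ U 1 := by simpa [hU0] using hUpos 0 hT
    have hd := hd2 hk
    have hcount : (univ.filter fun i : Fin N => (i : ℕ) < ∑ s, r s).card = ∑ s, r s := by
      rw [Fin.card_filter_val_lt, min_eq_right hN.le]
    have hsumd : ∑ t, dstar t = ∑ t, r t := by
      rw [sum_eq_single (⟨0, hT⟩ : Fin T)]
      · simp [hd]
      · intro t _ ht
        rw [hd, if_neg fun h => ht (Fin.ext h)]
      · simp
    refine ⟨fun i => if (i : ℕ) < ∑ s, r s then 1 else 0, fun _ => 0, ?_, ?_, ?_, ?_, ?_⟩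
    · intro i
      dsimp only
      split_ifs <;> omega
    · intro t
      rw [hd, durations]
      rcases Nat.eq_zero_or_pos (t : ℕ) with ht | ht
      · rw [if_pos ht, ht]
        refine Eq.trans (congrArg card (filter_congr fun i _ => ?_)) hcount
        split_ifs with h <;> simp [h]
      · rw [if_neg ht.ne', card_eq_zero, filter_eq_empty_iff]
        intro i _
        split_ifs <;> omega
    · refine majW_of_antitone hr hsumd.le fun t => ?_
      rcases Nat.eq_zero_or_pos (t : ℕ) with ht | ht
      · right
        intro s hs
        have : (s : ℕ) < t := hs
        omega
      · left
        intro s hs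
        have : (t : ℕ) ≤ s := hs
        rw [hd, if_neg (by omega)]
    · intro y _
      simp
    · intro h y hh hmaj
      have hle := hmaj.sum_le hT
      rw [sum_durations hh, sum_add_distrib] at hle
      have hle' : ∑ i, (h i : ℝ) ≤ ∑ t, (r t : ℝ) + ∑ t, (y t : ℝ) := by exact_mod_cast hle
      have hy : 0 ≤ ∑ t, (y t : ℝ) := sum_nonneg fun t _ => Nat.cast_nonneg _
      have hUh : ∑ i, U (h i) ≤ U 1 * ∑ i, (h i : ℝ) := by
        rw [mul_sum]
        exact sum_le_sum fun i _ => utility_le_mul hU0 hUconc (hh i)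
      have hopt : ∑ i : Fin N, U (if (i : ℕ) < ∑ s, r s then 1 else 0)
          = U 1 * ∑ t, (r t : ℝ) := by
        simp only [apply_ite U, hU0]
        rw [← sum_filter, sum_const, hcount, nsmul_eq_mul, mul_comm]
        push_cast
        rfl
      rw [hopt]
      have h1 := mul_le_mul_of_nonneg_left hle' hU1
      have h2 := mul_le_mul_of_nonneg_right hU1c.le hy
      simp only [Nat.cast_zero, sum_const_zero, mul_zero, sub_zero]
      linarith
  · have hex : ∃ k, 1 ≤ k ∧ k ≤ T ∧ c ≤ U k - U (k - 1) := by
      by_contra h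
      exact hk.ne' (hk2 h)
    obtain ⟨-, hkT, hck, hmax⟩ := hk1 hex
    have hd : ∀ t : Fin T, dstar t = if t ≤ (⟨kstar - 1, by omega⟩ : Fin T) then N else 0 := by
      intro t
      rw [hd1 hk]
      refine if_congr ?_ rfl rfl
      rw [Fin.le_def]
      dsimp only
      omega
    obtain ⟨ystar, hmajstar, hystar⟩ := exists_purchase hr hN _ hd
    have hdur : ∀ t : Fin T, durations (T := T) (fun _ : Fin N => kstar) t = dstar t := by
      intro t
      rw [hd1 hk, durations]
      split_ifs with h <;> simp [h]
    refine ⟨fun _ => kstar, ystar, fun _ => hkT, hdur, hmajstar, ?_, ?_⟩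
    · intro y hmaj
      have hle := hmaj.sum_le hT
      rw [sum_add_distrib] at hle
      omega
    · intro h y hh hmaj
      have hle := hmaj.sum_le hT
      rw [sum_durations hh, sum_add_distrib] at hle
      have hle' : ∑ i, (h i : ℝ) ≤ ∑ t, (r t : ℝ) + ∑ t, (y t : ℝ) := by exact_mod_cast hle
      rw [← sum_congr rfl fun t _ => hdur t, sum_durations fun _ => hkT] at hystar
      have hystar' : ∑ t, (r t : ℝ) + ∑ t, (ystar t : ℝ) = ∑ _i : Fin N, (kstar : ℝ) := by
        exact_mod_cast hystar
      have hnet : ∑ i, (U (h i) - c * h i) ≤ ∑ _i : Fin N, (U kstar - c * kstar) :=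
        sum_le_sum fun i _ => net_utility_le hUconc hk hkT hck hmax (hh i)
      rw [sum_sub_distrib, sum_sub_distrib, ← mul_sum, ← mul_sum, ← hystar'] at hnet
      have h1 := mul_le_mul_of_nonneg_left hle' hc
      linarith
end

section
/- (Rate-constrained services decompose into unit-rate services.) Let E, m be positive integers and write E = k·m + r with 0 ≤ r < m. A function A : {1,…,T} → ℕ satisfies A_t ∈ {0,1,…,m} for all t and ∑_{t=1}^T A_t = E if and only if there exist functions A^1,…,A^m : {1,…,T} → {0,1} with A_t = ∑_{n=1}^m A^n_t for all t, ∑_{t=1}^T A^n_t = k+1 for n = 1,…,r, and ∑_{t=1}^T A^n_t = k for n = r+1,…,m. -/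
open Finset

/-- Among the naturals below `b`, each lies in exactly one residue class modulo `m`. -/
theorem sum_count_modEq {m : ℕ} (hm : 0 < m) (b : ℕ) :
    ∑ n : Fin m, b.count (· ≡ n [MOD m]) = b := by
  induction b with
  | zero => simp
  | succ b ih =>
    simp only [Nat.count_succ, Finset.sum_add_distrib, ih]
    have h : ∀ n : Fin m, b ≡ n [MOD m] ↔ (⟨b % m, Nat.mod_lt b hm⟩ : Fin m) = n := by
      intro n
      rw [Nat.ModEq, Nat.mod_eq_of_lt n.2, Fin.ext_iff]
    simp [h]

theorem count_modEq_mul_add {m k r n : ℕ} (hr : r < m) (hn : n < m) :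
    (k * m + r).count (· ≡ n [MOD m]) = k + if n < r then 1 else 0 := by
  have hm : 0 < m := by omega
  rw [Nat.count_modEq_card _ hm, Nat.mod_eq_of_lt hn, mul_comm k m, Nat.mul_add_mod,
    Nat.mod_eq_of_lt hr, Nat.mul_add_div hm, Nat.div_eq_of_lt hr, add_zero]

/-- A block of at most `m` consecutive naturals meets each residue class at most once. -/
theorem count_modEq_add_le {m : ℕ} (hm : 0 < m) (x n : ℕ) {a : ℕ} (ha : a ≤ m) :
    (x + a).count (· ≡ n [MOD m]) ≤ x.count (· ≡ n [MOD m]) + 1 := by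
  refine (Nat.count_monotone _ (Nat.add_le_add_left ha x)).trans ?_
  rw [Nat.count_modEq_card _ hm, Nat.count_modEq_card _ hm, Nat.add_div_right _ hm,
    Nat.add_mod_right]
  omega

/-- Round-robin splitting: the energy units are numbered slot by slot, and service `n` receives
those whose number is congruent to `n` modulo `m`. -/
theorem exists_round_robin_split {T m : ℕ} (hm : 0 < m) (A : Fin T → ℕ) (hA : ∀ t, A t ≤ m) :
    ∃ B : Fin m → Fin T → ℕ, (∀ n t, B n t ≤ 1) ∧ (∀ t, A t = ∑ n, B n t) ∧
      ∀ n : Fin m, ∑ t, B n t = (∑ t, A t).count (· ≡ n [MOD m]) := by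
  let a : ℕ → ℕ := fun i => if h : i < T then A ⟨i, h⟩ else 0
  have ha : ∀ t : Fin T, a t = A t := fun t => by simp [a]
  let S : ℕ → ℕ := fun i => ∑ j ∈ Finset.range i, a j
  have hS : ∀ i, S (i + 1) = S i + a i := fun i => Finset.sum_range_succ a i
  have hST : S T = ∑ t, A t := by
    simp only [S, ← Fin.sum_univ_eq_sum_range, ha]
  let c : Fin m → ℕ → ℕ := fun n i => (S i).count (· ≡ n [MOD m])
  have hc : ∀ n, Monotone (c n) := fun n => (Nat.count_monotone _).comp
    (monotone_nat_of_le_succ fun i => (hS i).ge.trans' (Nat.le_add_right _ _))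
  refine ⟨fun n t => c n (t + 1) - c n t, fun n t => ?_, fun t => ?_, fun n => ?_⟩
  · have h := count_modEq_add_le hm (S t) n (hA t)
    rw [← ha, ← hS] at h
    exact Nat.sub_le_iff_le_add'.mpr h
  · rw [Finset.sum_tsub_distrib _ fun n _ => hc n (Nat.le_succ t)]
    simp only [c, sum_count_modEq hm, hS, ha, Nat.add_sub_cancel_left]
  · rw [Fin.sum_univ_eq_sum_range (fun t => c n (t + 1) - c n t), Finset.sum_range_tsub (hc n)]
    simp [c, hST, S]

/-- A rate-constrained energy service `(E, m)` decomposes into `m` unit-rate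
duration-differentiated services: an allocation `A` with slot values in
`{0,…,m}` and total energy `E = k·m + r` (`0 ≤ r < m`) exists exactly when `A`
is a sum of `m` 0/1-valued allocations, `r` of which deliver `k+1` slots and
`m − r` of which deliver `k` slots. -/
theorem rate_constrained_decomposition {T : ℕ} (E m k r : ℕ)
    (hE : 0 < E) (hm : 0 < m) (hr : r < m) (hEkm : E = k * m + r)
    (A : Fin T → ℕ) :
    ((∀ t, A t ≤ m) ∧ ∑ t, A t = E) ↔
      ∃ B : Fin m → Fin T → ℕ,
        (∀ n t, B n t ≤ 1) ∧
        (∀ t, A t = ∑ n, B n t) ∧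
        (∀ n : Fin m, (n : ℕ) < r → ∑ t, B n t = k + 1) ∧
        (∀ n : Fin m, r ≤ (n : ℕ) → ∑ t, B n t = k) := by
  subst hEkm
  constructor
  · rintro ⟨hA, hsum⟩
    obtain ⟨B, hB, hAB, hBsum⟩ := exists_round_robin_split hm A hA
    simp only [hsum, count_modEq_mul_add hr (Fin.is_lt _)] at hBsum
    exact ⟨B, hB, hAB, fun n hn => by simp [hBsum, hn], fun n hn => by simp [hBsum, hn]⟩
  · rintro ⟨B, hB, hAB, hlt, hge⟩
    refine ⟨fun t => ?_, ?_⟩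
    · rw [hAB]
      exact (Finset.sum_le_card_nsmul _ _ 1 fun n _ => hB n t).trans (by simp)
    · have hBsum : ∀ n : Fin m, ∑ t, B n t = (k * m + r).count (· ≡ n [MOD m]) := by
        intro n
        rw [count_modEq_mul_add hr n.2]
        split_ifs with hn
        · exact hlt n hn
        · exact hge n (not_lt.mp hn)
      simp only [hAB]
      rw [Finset.sum_comm]
      simp only [hBsum, sum_count_modEq hm]
end

section
/- Let a, b ∈ ℕ^T be nonincreasing vectors with a ⪯ b. If for some index t with 1 ≤ t ≤ T it holds that a_j = b_j for all j < t and a_t − a_T ≤ 1, then a_t = b_t, and moreover a = b. -/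
open Finset

/-- Tail-sum domination also holds for the open tails. -/
theorem sum_Ioi_le_of_sum_Ici_le {T : ℕ} {a b : Fin T → ℕ}
    (h : ∀ u : Fin T, ∑ s ∈ Ici u, a s ≤ ∑ s ∈ Ici u, b s) (i : Fin T) :
    ∑ s ∈ Ioi i, a s ≤ ∑ s ∈ Ioi i, b s := by
  by_cases hi : i.val + 1 < T
  · have hIoi : Ioi i = Ici ⟨i.val + 1, hi⟩ := by
      ext s
      simp only [mem_Ioi, mem_Ici, Fin.lt_def, Fin.le_def]
      omega
    rw [hIoi]
    exact h _
  · have hIoi : Ioi i = ∅ := by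
      ext s
      have := s.isLt
      simp only [mem_Ioi, Fin.lt_def, notMem_empty, iff_false]
      omega
    simp [hIoi]

/-- A total over `Fin T` splits at an index `i`. -/
theorem sum_eq_sum_Iio_add_sum_Ioi {T : ℕ} (f : Fin T → ℕ) (i : Fin T) :
    ∑ s, f s = ∑ s ∈ Iio i, f s + (f i + ∑ s ∈ Ioi i, f s) := by
  rw [← sum_insert (by simp), Ioi_insert, ← sum_union]
  · congr 1
    ext s
    simp [lt_or_ge]
  · exact disjoint_left.2 fun s hs ht => (mem_Iio.1 hs).not_ge (mem_Ici.1 ht)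

/-- For nonincreasing `a b : ℕ^T` with `a ⪯ b` (tail sums of `a` dominated by
those of `b`, equal totals): if `a` and `b` agree strictly before index `t` and
`a t ≤ a_{T} + 1` (the entries of `a` from `t` on are within 1 of each other),
then `a t = b t`, and moreover `a = b`. -/
theorem majorize_flat_tail_eq {T : ℕ} (hT : 0 < T) (a b : Fin T → ℕ)
    (ha : Antitone a) (hb : Antitone b)
    (hmaj : (∀ u : Fin T, ∑ s ∈ Ici u, a s ≤ ∑ s ∈ Ici u, b s) ∧
      ∑ s, a s = ∑ s, b s)
    (t : Fin T)
    (hpre : ∀ j, j < t → a j = b j)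
    (hflat : a t ≤ a ⟨T - 1, by omega⟩ + 1) :
    a t = b t ∧ a = b := by
  have hab : ∀ i, a i = b i := by
    intro i
    induction i using WellFoundedLT.induction with
    | ind i ih =>
      rcases lt_or_ge i t with hi | hi
      · exact hpre i hi
      · apply le_antisymm
        · by_contra! hlt
          have hai := ha hi
          have htail : ∑ s ∈ Ici i, b s < ∑ s ∈ Ici i, a s := by
            refine sum_lt_sum (fun s hs => ?_) ⟨i, by simp, hlt⟩
            have hbs := hb (mem_Ici.1 hs)
            have has : a ⟨T - 1, by omega⟩ ≤ a s :=
              ha (Fin.le_def.2 (Nat.le_sub_one_of_lt s.isLt))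
            omega
          exact htail.not_ge (hmaj.1 i)
        · have hprefix : ∑ s ∈ Iio i, a s = ∑ s ∈ Iio i, b s :=
            sum_congr rfl fun s hs => ih s (mem_Iio.1 hs)
          have htail := sum_Ioi_le_of_sum_Ici_le hmaj.1 i
          have htotal := hmaj.2
          rw [sum_eq_sum_Iio_add_sum_Ioi a i, sum_eq_sum_Iio_add_sum_Ioi b i] at htotal
          omega
  exact ⟨hab t, funext hab⟩
end

section
/- Let U : ℕ → ℝ satisfy U(0) = 0 with nonnegative, nonincreasing increments (U(h) − U(h−1) is nonnegative and nonincreasing in h). Let N, u, S be nonnegative integers with 0 ≤ S < N. Then for all nonnegative integers h_1, …, h_N with ∑_{i=1}^N h_i ≤ N·u + S, one has ∑_{i=1}^N U(h_i) ≤ S·U(u+1) + (N − S)·U(u); that is, total concave utility is maximized by the balanced allocation in which S consumers receive u+1 slots and N − S consumers receive u slots. -/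
open Finset

/-- A sequence with nonincreasing increments lies below the line through its values
at `u` and `u + 1`. -/
theorem le_add_increment_mul_sub_of_concave {U : ℕ → ℝ}
    (hU : ∀ k : ℕ, U (k + 2) - U (k + 1) ≤ U (k + 1) - U k) (u m : ℕ) :
    U m ≤ U u + (U (u + 1) - U u) * ((m : ℝ) - u) := by
  have hanti : Antitone fun k => U (k + 1) - U k := antitone_nat_of_succ_le hU
  rcases le_total u m with hum | hmu
  · induction m, hum using Nat.le_induction with
    | base => simp
    | succ m hum ih =>
      have hd : U (m + 1) - U m ≤ U (u + 1) - U u := hanti hum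
      push_cast
      linarith
  · induction hmu using Nat.decreasingInduction with
    | self => simp
    | of_succ m hm ih =>
      have hd : U (u + 1) - U u ≤ U (m + 1) - U m := hanti hm.le
      push_cast at ih
      linarith

/-- With a concave utility (`U 0 = 0`, nonnegative nonincreasing increments),
total utility under any allocation `h` with `∑ h_i ≤ N·u + S` (`0 ≤ S < N`) is
at most that of the balanced allocation where `S` consumers receive `u+1` slots
and `N − S` consumers receive `u` slots. -/
theorem concave_balanced_allocation_optimal (U : ℕ → ℝ) (hU0 : U 0 = 0)
    (hUpos : ∀ k : ℕ, U k ≤ U (k + 1))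
    (hUconc : ∀ k : ℕ, U (k + 2) - U (k + 1) ≤ U (k + 1) - U k)
    (N u S : ℕ) (hS : S < N)
    (h : Fin N → ℕ) (hsum : ∑ i, h i ≤ N * u + S) :
    ∑ i, U (h i) ≤ (S : ℝ) * U (u + 1) + ((N : ℝ) - (S : ℝ)) * U u := by
  have hsum' : (∑ i, (h i : ℝ)) ≤ N * u + S := by exact_mod_cast hsum
  calc ∑ i, U (h i)
      ≤ ∑ i, (U u + (U (u + 1) - U u) * ((h i : ℝ) - u)) :=
        sum_le_sum fun i _ => le_add_increment_mul_sub_of_concave hUconc u (h i)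
    _ = N * U u + (U (u + 1) - U u) * ((∑ i, (h i : ℝ)) - N * u) := by
        simp [sum_add_distrib, ← mul_sum]
    _ ≤ N * U u + (U (u + 1) - U u) * S := by
        have := sub_nonneg.2 (hUpos u)
        gcongr
        linarith
    _ = (S : ℝ) * U (u + 1) + ((N : ℝ) - (S : ℝ)) * U u := by ring
end
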